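/- The set {(1/2, √3/16), (1/2, 3√3/8)} is the unique optimal set of two-means for P: every set α ⊆ ℝ² with card α ≤ 2 satisfying ∫ min_{a∈α} ‖x − a‖² dP(x) = V₂(P) equals {(1/2, √3/16), (1/2, 3√3/8)}. -/

import Mathlib

open MeasureTheory Real Set
open scoped ENNReal NNReal

/-- The three contractive similarities generating the nonhomogeneous R-triangle.
Letters 1,2,3 of the paper correspond to `0,1,2 : Fin 3`. -/
noncomputable def Smap : Fin 3 → ℝ × ℝ → ℝ × ℝ :=
  ![fun x => (x.1 / 4, x.2 / 4),
    fun x => (x.1 / 4 + 3 / 4, x.2 / 4),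
    fun x => (x.1 / 2 + 1 / 4, x.2 / 2 + Real.sqrt 3 / 4)]

/-- `Sw ω = S_{ω₁} ∘ ⋯ ∘ S_{ω_k}` for a word `ω = ω₁⋯ω_k`. -/
noncomputable def Sw (ω : List (Fin 3)) : ℝ × ℝ → ℝ × ℝ :=
  (ω.map Smap).foldr (· ∘ ·) id

/-- The probability weights `p₁ = p₂ = 1/5`, `p₃ = 3/5`. -/
noncomputable def pr : Fin 3 → ℝ := ![1/5, 1/5, 3/5]

/-- The similarity ratios `s₁ = s₂ = 1/4`, `s₃ = 1/2`. -/
noncomputable def sr : Fin 3 → ℝ := ![1/4, 1/4, 1/2]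

/-- `p_ω = p_{ω₁}⋯p_{ω_k}`. -/
noncomputable def pw (ω : List (Fin 3)) : ℝ := (ω.map pr).prod

/-- `s_ω = s_{ω₁}⋯s_{ω_k}`. -/
noncomputable def sw (ω : List (Fin 3)) : ℝ := (ω.map sr).prod

/-- `P` is the nonhomogeneous R-measure:
`P = (1/5)·P∘S₁⁻¹ + (1/5)·P∘S₂⁻¹ + (3/5)·P∘S₃⁻¹`. -/
def IsRMeasure (P : Measure (ℝ × ℝ)) : Prop :=
  P = (1/5 : ℝ≥0∞) • P.map (Smap 0) + (1/5 : ℝ≥0∞) • P.map (Smap 1)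
        + (3/5 : ℝ≥0∞) • P.map (Smap 2)

/-- The closed equilateral triangle with vertices (0,0), (1,0), (1/2, √3/2). -/
noncomputable def Δtri : Set (ℝ × ℝ) :=
  convexHull ℝ ({(0, 0), (1, 0), (1/2, Real.sqrt 3 / 2)} : Set (ℝ × ℝ))

/-- Squared Euclidean distance on ℝ². -/
def sqDist (x a : ℝ × ℝ) : ℝ := (x.1 - a.1) ^ 2 + (x.2 - a.2) ^ 2

/-- The distortion error `∫ min_{a ∈ α} ‖x − a‖² dP(x)` of a set `α` (Euclidean norm). -/
noncomputable def distortion (P : Measure (ℝ × ℝ)) (α : Set (ℝ × ℝ)) : ℝ :=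
  ∫ x, sInf ((fun a => sqDist x a) '' α) ∂P

/-- The `n`th quantization error `Vₙ(P)`. -/
noncomputable def quantErr (P : Measure (ℝ × ℝ)) (n : ℕ) : ℝ :=
  sInf { v | ∃ α : Set (ℝ × ℝ), 1 ≤ α.encard ∧ α.encard ≤ (n : ℕ∞) ∧ v = distortion P α }

/-- `α` is an optimal set of `n`-means for `P`. -/
def IsOptimalSet (P : Measure (ℝ × ℝ)) (n : ℕ) (α : Set (ℝ × ℝ)) : Prop :=
  1 ≤ α.encard ∧ α.encard ≤ (n : ℕ∞) ∧ distortion P α = quantErr P n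

/-! ### The measure: support, integrability, self-similarity of integrals -/

section Measure

variable {P : Measure (ℝ × ℝ)}

lemma Smap_zero_apply (x : ℝ × ℝ) : Smap 0 x = (x.1 / 4, x.2 / 4) := rfl

lemma Smap_one_apply (x : ℝ × ℝ) : Smap 1 x = (x.1 / 4 + 3 / 4, x.2 / 4) := rfl

lemma Smap_two_apply (x : ℝ × ℝ) : Smap 2 x = (x.1 / 2 + 1 / 4, x.2 / 2 + √3 / 4) := rfl

lemma continuous_Smap (i : Fin 3) : Continuous (Smap i) := by
  match i with
  | 0 =>
    exact (continuous_fst.div_const (4 : ℝ)).prodMk (continuous_snd.div_const (4 : ℝ))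
  | 1 =>
    exact ((continuous_fst.div_const (4 : ℝ)).add_const _).prodMk
      (continuous_snd.div_const (4 : ℝ))
  | 2 =>
    exact ((continuous_fst.div_const (2 : ℝ)).add_const _).prodMk
      ((continuous_snd.div_const (2 : ℝ)).add_const _)

lemma IsRMeasure.measure_eq (hP : IsRMeasure P) {A : Set (ℝ × ℝ)} (hA : MeasurableSet A) :
    P A = 1 / 5 * P (Smap 0 ⁻¹' A) + 1 / 5 * P (Smap 1 ⁻¹' A) + 3 / 5 * P (Smap 2 ⁻¹' A) := by
  conv_lhs => rw [hP]
  simp [Measure.map_apply (continuous_Smap _).measurable hA]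

/-- A half-space that is mapped into itself in an expanding way by the inverse branches
carries the whole mass. -/
lemma IsRMeasure.ae_nonneg [IsProbabilityMeasure P] (hP : IsRMeasure P) {f : ℝ × ℝ → ℝ}
    (hf : Measurable f) (h : ∀ i x, f (Smap i x) < 0 → f x ≤ 2 * f (Smap i x)) :
    ∀ᵐ x ∂P, 0 ≤ f x := by
  have hm (R : ℝ) : MeasurableSet {x | f x < -R} := measurableSet_lt hf measurable_const
  have step : ∀ R > 0, P {x | f x < -R} ≤ P {x | f x < -(2 * R)} := by
    intro R hR
    have hsub (i : Fin 3) : P (Smap i ⁻¹' {x | f x < -R}) ≤ P {x | f x < -(2 * R)} := by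
      refine measure_mono fun x hx => ?_
      have hx : f (Smap i x) < -R := hx
      have := h i x (by linarith)
      change f x < -(2 * R)
      linarith
    have hsum : (1 / 5 + 1 / 5 + 3 / 5 : ℝ≥0∞) = 1 := by
      rw [ENNReal.div_add_div_same, ENNReal.div_add_div_same]
      norm_num
      exact ENNReal.div_self (by norm_num) (by norm_num)
    calc P {x | f x < -R} = _ := hP.measure_eq (hm R)
      _ ≤ 1 / 5 * P {x | f x < -(2 * R)} + 1 / 5 * P {x | f x < -(2 * R)}
          + 3 / 5 * P {x | f x < -(2 * R)} := by
        refine add_le_add (add_le_add ?_ ?_) ?_ <;> exact mul_le_mul' le_rfl (hsub _)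
      _ = P {x | f x < -(2 * R)} := by rw [← add_mul, ← add_mul, hsum, one_mul]
  have iter : ∀ R > 0, ∀ k : ℕ, P {x | f x < -R} ≤ P {x | f x < -(2 ^ k * R)} := by
    intro R hR k
    induction k with
    | zero => simp
    | succ k ih =>
      refine ih.trans ((step _ (by positivity)).trans_eq ?_)
      rw [pow_succ', mul_assoc]
  have zero : ∀ R > 0, P {x | f x < -R} = 0 := by
    intro R hR
    have hlim := tendsto_measure_iInter_atTop (μ := P)
      (s := fun k : ℕ => {x | f x < -(2 ^ k * R)}) (fun k => (hm _).nullMeasurableSet)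
      (by
        intro k l hkl x hx
        have hx : f x < -(2 ^ l * R) := hx
        have : (2 : ℝ) ^ k * R ≤ 2 ^ l * R := by gcongr; norm_num
        change f x < -(2 ^ k * R)
        linarith) ⟨0, measure_ne_top _ _⟩
    have hempty : (⋂ k : ℕ, {x | f x < -(2 ^ k * R)}) = ∅ := by
      refine Set.eq_empty_of_forall_notMem fun x hx => ?_
      obtain ⟨k, hk⟩ := pow_unbounded_of_one_lt (-f x / R) (one_lt_two (α := ℝ))
      have hxk : f x < -(2 ^ k * R) := Set.mem_iInter.1 hx k
      rw [div_lt_iff₀ hR] at hk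
      linarith
    rw [hempty, measure_empty] at hlim
    exact le_antisymm (ge_of_tendsto' hlim (iter R hR)) zero_le
  rw [ae_iff]
  refine measure_mono_null (t := ⋃ n : ℕ, {x | f x < -(1 / (n + 1 : ℝ))}) (fun x hx => ?_)
    (measure_iUnion_null fun n => zero _ (by positivity))
  have hx : ¬ 0 ≤ f x := hx
  obtain ⟨n, hn⟩ := exists_nat_one_div_lt (show 0 < -f x by linarith)
  exact Set.mem_iUnion.2 ⟨n, show f x < _ by linarith⟩

/-- `P` is supported by the triangle, described by three linear inequalities. -/
lemma IsRMeasure.ae_mem_triangle [IsProbabilityMeasure P] (hP : IsRMeasure P) :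
    ∀ᵐ x ∂P, 0 ≤ x.2 ∧ 0 ≤ √3 * x.1 - x.2 ∧ 0 ≤ √3 * (1 - x.1) - x.2 := by
  have h3 : 0 < √3 := by positivity
  have h₀ := hP.ae_nonneg (f := fun x => x.2) (by fun_prop) fun i x => by
    match i with
    | 0 => simp only [Smap_zero_apply]; intro; linarith
    | 1 => simp only [Smap_one_apply]; intro; linarith
    | 2 => simp only [Smap_two_apply]; intro; linarith
  have h₁ := hP.ae_nonneg (f := fun x => √3 * x.1 - x.2) (by fun_prop) fun i x => by
    match i with
    | 0 => simp only [Smap_zero_apply]; intro; linarith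
    | 1 => simp only [Smap_one_apply]; intro; linarith
    | 2 => simp only [Smap_two_apply]; intro; linarith
  have h₂ := hP.ae_nonneg (f := fun x => √3 * (1 - x.1) - x.2) (by fun_prop) fun i x => by
    match i with
    | 0 => simp only [Smap_zero_apply]; intro; linarith
    | 1 => simp only [Smap_one_apply]; intro; linarith
    | 2 => simp only [Smap_two_apply]; intro; linarith
  filter_upwards [h₀, h₁, h₂] with x a b c using ⟨a, b, c⟩

lemma IsRMeasure.integrable [IsProbabilityMeasure P] (hP : IsRMeasure P) {f : ℝ × ℝ → ℝ}
    (hf : Continuous f) : Integrable f P := by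
  obtain ⟨C, hC⟩ := ((isCompact_Icc (a := (0 : ℝ)) (b := 1)).prod
    (isCompact_Icc (a := (0 : ℝ)) (b := √3))).exists_bound_of_continuousOn hf.continuousOn
  refine Integrable.of_bound hf.aestronglyMeasurable C ?_
  have h3 : 0 < √3 := by positivity
  filter_upwards [hP.ae_mem_triangle] with x ⟨h₀, h₁, h₂⟩
  refine hC x ⟨⟨?_, ?_⟩, h₀, ?_⟩
  · exact nonneg_of_mul_nonneg_right (by linarith : 0 ≤ √3 * x.1) h3
  · exact sub_nonneg.1 (nonneg_of_mul_nonneg_right (by linarith : 0 ≤ √3 * (1 - x.1)) h3)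
  · linarith

lemma IsRMeasure.integral_eq [IsProbabilityMeasure P] (hP : IsRMeasure P) {f : ℝ × ℝ → ℝ}
    (hf : Continuous f) :
    ∫ x, f x ∂P = 1 / 5 * ∫ x, f (x.1 / 4, x.2 / 4) ∂P
      + 1 / 5 * ∫ x, f (x.1 / 4 + 3 / 4, x.2 / 4) ∂P
      + 3 / 5 * ∫ x, f (x.1 / 2 + 1 / 4, x.2 / 2 + √3 / 4) ∂P := by
  have hi (i : Fin 3) (c : ℝ≥0∞) (hc : c ≠ ∞) : Integrable f (c • P.map (Smap i)) := by
    refine Integrable.smul_measure ?_ hc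
    rw [integrable_map_measure hf.aestronglyMeasurable (continuous_Smap i).aemeasurable]
    exact hP.integrable (hf.comp (continuous_Smap i))
  have h5 (c : ℝ≥0∞) (hc : c ≠ ∞) : c / 5 ≠ ∞ := ENNReal.div_ne_top hc (by norm_num)
  have hm (i : Fin 3) : ∫ x, f x ∂(P.map (Smap i)) = ∫ x, f (Smap i x) ∂P :=
    integral_map (continuous_Smap i).aemeasurable hf.aestronglyMeasurable
  conv_lhs => rw [hP]
  rw [integral_add_measure ((hi 0 _ (h5 1 (by norm_num))).add_measure
      (hi 1 _ (h5 1 (by norm_num)))) (hi 2 _ (h5 3 (by norm_num))),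
    integral_add_measure (hi 0 _ (h5 1 (by norm_num))) (hi 1 _ (h5 1 (by norm_num))),
    integral_smul_measure, integral_smul_measure, integral_smul_measure, hm, hm, hm]
  simp [Smap_zero_apply, Smap_one_apply, Smap_two_apply]

lemma IsRMeasure.integral_fst [IsProbabilityMeasure P] (hP : IsRMeasure P) :
    ∫ x, x.1 ∂P = 1 / 2 := by
  have i1 : Integrable (fun x : ℝ × ℝ => x.1) P := hP.integrable (by fun_prop)
  have h := hP.integral_eq (f := fun x => x.1) (by fun_prop)
  dsimp only at h
  rw [integral_add (i1.div_const _) (integrable_const _),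
    integral_add (i1.div_const _) (integrable_const _)] at h
  simp only [integral_div, integral_const, probReal_univ, one_smul] at h
  linarith

lemma IsRMeasure.integral_snd [IsProbabilityMeasure P] (hP : IsRMeasure P) :
    ∫ x, x.2 ∂P = √3 / 4 := by
  have i1 : Integrable (fun x : ℝ × ℝ => x.2) P := hP.integrable (by fun_prop)
  have h := hP.integral_eq (f := fun x => x.2) (by fun_prop)
  dsimp only at h
  rw [integral_add (i1.div_const _) (integrable_const _)] at h
  simp only [integral_div, integral_const, probReal_univ, one_smul] at h
  linarith

lemma IsRMeasure.integral_affine [IsProbabilityMeasure P] (hP : IsRMeasure P) (A B C : ℝ) :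
    ∫ x, (A * x.1 + B * x.2 + C) ∂P = A / 2 + B * √3 / 4 + C := by
  have i1 : Integrable (fun x : ℝ × ℝ => A * x.1) P := hP.integrable (by fun_prop)
  have i2 : Integrable (fun x : ℝ × ℝ => B * x.2) P := hP.integrable (by fun_prop)
  have i12 : Integrable (fun x : ℝ × ℝ => A * x.1 + B * x.2) P := hP.integrable (by fun_prop)
  rw [integral_add i12 (integrable_const _), integral_add i1 i2,
    integral_const_mul, integral_const_mul, hP.integral_fst, hP.integral_snd]
  simp
  ring

lemma IsRMeasure.integral_snd_sq [IsProbabilityMeasure P] (hP : IsRMeasure P) :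
    ∫ x, x.2 ^ 2 ∂P = 3 / 11 := by
  have h3 : √3 ^ 2 = 3 := by norm_num
  have i2 : Integrable (fun x : ℝ × ℝ => x.2 ^ 2) P := hP.integrable (by fun_prop)
  have h := hP.integral_eq (f := fun x => x.2 ^ 2) (by fun_prop)
  have e1 : ∫ x, (x.2 / 4) ^ 2 ∂P = 1 / 16 * ∫ x, x.2 ^ 2 ∂P := by
    rw [← integral_const_mul]; congr 1; ext x; ring
  have e2 : ∫ x, (x.2 / 2 + √3 / 4) ^ 2 ∂P = 1 / 4 * ∫ x, x.2 ^ 2 ∂P + 3 / 8 := by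
    have : ∀ x : ℝ × ℝ, (x.2 / 2 + √3 / 4) ^ 2
        = 1 / 4 * x.2 ^ 2 + (0 * x.1 + √3 / 4 * x.2 + 3 / 16) := by
      intro x; linear_combination h3 / 16
    simp_rw [this]
    rw [integral_add (i2.const_mul _) (hP.integrable (by fun_prop)), integral_const_mul,
      hP.integral_affine]
    linear_combination h3 / 16
  dsimp only at h
  rw [e1, e2] at h
  linarith

/-- The second moment about the origin exceeds `‖m‖² + 9/128 = 65/128`. -/
lemma IsRMeasure.lt_integral_sq_add_sq [IsProbabilityMeasure P] (hP : IsRMeasure P) :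
    65 / 128 < ∫ x, (x.1 ^ 2 + x.2 ^ 2) ∂P := by
  have i1 : Integrable (fun x : ℝ × ℝ => x.1 ^ 2) P := hP.integrable (by fun_prop)
  have i2 : Integrable (fun x : ℝ × ℝ => x.2 ^ 2) P := hP.integrable (by fun_prop)
  rw [integral_add i1 i2, hP.integral_snd_sq]
  have h : ∫ x, (1 * x.1 + 0 * x.2 + (-1 / 4)) ∂P ≤ ∫ x, x.1 ^ 2 ∂P :=
    integral_mono (hP.integrable (by fun_prop)) i1 fun x => by
      dsimp only; nlinarith [sq_nonneg (x.1 - 1 / 2)]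
  rw [hP.integral_affine] at h
  linarith

/-- The integral of the positive part of an affine function. -/
noncomputable def posPartInt (P : Measure (ℝ × ℝ)) (A B C : ℝ) : ℝ :=
  ∫ x, max (A * x.1 + B * x.2 + C) 0 ∂P

lemma IsRMeasure.posPartInt_eq [IsProbabilityMeasure P] (hP : IsRMeasure P) (A B C : ℝ) :
    posPartInt P A B C = 1 / 5 * posPartInt P (A / 4) (B / 4) C
      + 1 / 5 * posPartInt P (A / 4) (B / 4) (C + 3 * A / 4)
      + 3 / 5 * posPartInt P (A / 2) (B / 2) (C + A / 4 + B * √3 / 4) := by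
  have e₁ (x : ℝ × ℝ) : A * (x.1 / 4) + B * (x.2 / 4) + C = A / 4 * x.1 + B / 4 * x.2 + C := by
    ring
  have e₂ (x : ℝ × ℝ) : A * (x.1 / 4 + 3 / 4) + B * (x.2 / 4) + C
      = A / 4 * x.1 + B / 4 * x.2 + (C + 3 * A / 4) := by ring
  have e₃ (x : ℝ × ℝ) : A * (x.1 / 2 + 1 / 4) + B * (x.2 / 2 + √3 / 4) + C
      = A / 2 * x.1 + B / 2 * x.2 + (C + A / 4 + B * √3 / 4) := by ring
  unfold posPartInt
  rw [hP.integral_eq (by fun_prop)]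
  simp only [e₁, e₂, e₃]

lemma posPartInt_nonneg (A B C : ℝ) : 0 ≤ posPartInt P A B C :=
  integral_nonneg fun _ => le_max_right _ _

lemma IsRMeasure.le_posPartInt [IsProbabilityMeasure P] (hP : IsRMeasure P) (A B C : ℝ) :
    A / 2 + B * √3 / 4 + C ≤ posPartInt P A B C := by
  rw [← hP.integral_affine]
  exact integral_mono (hP.integrable (by fun_prop)) (hP.integrable (by fun_prop))
    fun x => le_max_left _ _

/-- Convexity bound: a positive part is dominated by the interpolation of its values at
the vertices of the triangle. -/
lemma IsRMeasure.posPartInt_le [IsProbabilityMeasure P] (hP : IsRMeasure P) (A B C : ℝ) :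
    posPartInt P A B C ≤ 1 / 4 * max C 0 + 1 / 4 * max (A + C) 0
      + 1 / 2 * max (A / 2 + B * √3 / 2 + C) 0 := by
  have h3 : 0 < √3 := by positivity
  have hsq : √3 * √3 = 3 := by norm_num
  set p := max C 0
  set q := max (A + C) 0
  set s := max (A / 2 + B * √3 / 2 + C) 0
  have key : posPartInt P A B C ≤
      ∫ x, ((q - p) * x.1 + ((2 * s - p - q) * √3 / 3) * x.2 + p) ∂P := by
    refine integral_mono_ae (hP.integrable (by fun_prop)) (hP.integrable (by fun_prop)) ?_
    filter_upwards [hP.ae_mem_triangle] with x ⟨h₀, h₁, h₂⟩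
    have e₀ : 0 ≤ √3 * x.2 := by positivity
    have e₁ : 0 ≤ 3 * x.1 - √3 * x.2 := by nlinarith
    have e₂ : 0 ≤ 3 * (1 - x.1) - √3 * x.2 := by nlinarith
    have hp : C ≤ p := le_max_left _ _
    have hq : A + C ≤ q := le_max_left _ _
    have hs : A / 2 + B * √3 / 2 + C ≤ s := le_max_left _ _
    have hp' : 0 ≤ p := le_max_right _ _
    have hq' : 0 ≤ q := le_max_right _ _
    have hs' : 0 ≤ s := le_max_right _ _
    refine max_le ?_ ?_
    · have t₀ := mul_nonneg (sub_nonneg.2 hs) e₀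
      have t₁ := mul_nonneg (sub_nonneg.2 hq) e₁
      have t₂ := mul_nonneg (sub_nonneg.2 hp) e₂
      have : B * x.2 = B * √3 * (√3 * x.2) / 3 := by linear_combination -(B * x.2 / 3) * hsq
      linarith
    · linarith [mul_nonneg hs' e₀, mul_nonneg hq' e₁, mul_nonneg hp' e₂]
  rw [hP.integral_affine] at key
  linear_combination key + (2 * s - p - q) / 12 * hsq

end Measure

/-! ### A finite check over the half-plane cuts of fifteen atoms -/

/-- Atoms `(w, x, y)` of mass `w/100` at `(x/16, √3 y/16)`, grouped into collinear runs.
They are the vertices of the triangles of the cells `1, 2, 31, 32, 33`. -/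
def atomRuns : List (List (ℕ × ℕ × ℕ)) :=
  [[(5, 0, 0), (10, 2, 2), (3, 4, 4), (6, 5, 5), (9, 6, 6), (18, 8, 8)],
   [(5, 16, 0), (10, 14, 2), (3, 12, 4), (6, 11, 5), (9, 10, 6)],
   [(5, 4, 0), (5, 12, 0)],
   [(3, 6, 4), (3, 10, 4)]]

/-- Total mass and first moments of a list of atoms. -/
def moments (l : List (ℕ × ℕ × ℕ)) : ℕ × ℕ × ℕ :=
  l.foldr (fun t m => (t.1 + m.1, t.1 * t.2.1 + m.2.1, t.1 * t.2.2 + m.2.2)) (0, 0, 0)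

/-- The mass and first moments `n, X, Y` of one side of a cut are either those of the empty
cut, of the cut separating the third cell, or give strictly less between-group variance. -/
def isGoodCut (n X Y : ℕ) : Bool :=
  (n.blt 100 && (5 * (X * X + 3 * (Y * Y)) + 650 * (n * n)).blt
      (9000 * n + 80 * (n * X) + 120 * (n * Y))) ||
  (n.beq 60 && X.beq 480 && Y.beq 360) || (n.beq 40 && X.beq 320 && Y.beq 40) ||
  (n.beq 0 && X.beq 0 && Y.beq 0) || (n.beq 100 && X.beq 800 && Y.beq 400)

/-- Every choice of an end segment in each of the runs yields a good cut. -/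
def checkCuts : List (List (ℕ × ℕ × ℕ)) → ℕ → ℕ → ℕ → Bool
  | [], n, X, Y => isGoodCut n X Y
  | g :: gs, n, X, Y => ((g.tails ++ g.reverse.tails).map moments).all fun m =>
      checkCuts gs (n + m.1) (X + m.2.1) (Y + m.2.2)

lemma checkCuts_atomRuns : checkCuts atomRuns 0 0 0 = true := by
  decide +kernel

/-- Value at an atom of the affine function with coefficients `u, v, c`. -/
noncomputable def atomVal (u v c : ℝ) (t : ℕ × ℕ × ℕ) : ℝ := u * t.2.1 + v * t.2.2 + c

/-- The linear functional on mass and first moments given by an affine function. -/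
noncomputable def momVal (u v c : ℝ) (m : ℕ × ℕ × ℕ) : ℝ := u * m.2.1 + v * m.2.2 + c * m.1

/-- The sum of the positive parts of an affine function over a list of atoms. -/
noncomputable def posSum (u v c : ℝ) (l : List (ℕ × ℕ × ℕ)) : ℝ :=
  (l.map fun t => t.1 * max (atomVal u v c t) 0).sum

lemma posSum_cons (u v c : ℝ) (t : ℕ × ℕ × ℕ) (l : List (ℕ × ℕ × ℕ)) :
    posSum u v c (t :: l) = t.1 * max (atomVal u v c t) 0 + posSum u v c l := by
  simp [posSum]

lemma posSum_reverse (u v c : ℝ) (l : List (ℕ × ℕ × ℕ)) :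
    posSum u v c l.reverse = posSum u v c l := by
  simp [posSum, List.sum_reverse]

lemma posSum_eq_momVal_moments {u v c : ℝ} {l : List (ℕ × ℕ × ℕ)}
    (h : ∀ t ∈ l, 0 ≤ atomVal u v c t) : posSum u v c l = momVal u v c (moments l) := by
  induction l with
  | nil => simp [posSum, momVal, moments]
  | cons t l ih =>
    rw [posSum_cons, ih fun s hs => h s (List.mem_cons_of_mem _ hs),
      max_eq_left (h t List.mem_cons_self)]
    simp only [momVal, moments, List.foldr_cons, atomVal]
    push_cast
    ring

lemma exists_tail_posSum_eq {u v c : ℝ} {l : List (ℕ × ℕ × ℕ)}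
    (h : l.Pairwise fun s t => atomVal u v c s ≤ atomVal u v c t) :
    ∃ s ∈ l.tails, posSum u v c l = momVal u v c (moments s) := by
  induction l with
  | nil => exact ⟨[], by simp, by simp [posSum, momVal, moments]⟩
  | cons t l ih =>
    rw [List.pairwise_cons] at h
    rcases le_total 0 (atomVal u v c t) with ht | ht
    · refine ⟨t :: l, by simp, posSum_eq_momVal_moments fun s hs => ?_⟩
      rcases List.mem_cons.1 hs with rfl | hs
      · exact ht
      · exact ht.trans (h.1 s hs)
    · obtain ⟨s, hs, e⟩ := ih h.2
      refine ⟨s, by simp only [List.tails_cons, List.mem_cons, hs, or_true], ?_⟩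
      rw [posSum_cons, max_eq_right ht, mul_zero, zero_add, e]

lemma exists_isGoodCut_of_checkCuts {u v c : ℝ} {gs : List (List (ℕ × ℕ × ℕ))}
    (hgs : ∀ g ∈ gs, (g.Pairwise fun s t => atomVal u v c s ≤ atomVal u v c t) ∨
      g.Pairwise fun s t => atomVal u v c t ≤ atomVal u v c s)
    {n X Y : ℕ} (h : checkCuts gs n X Y = true) :
    ∃ n' X' Y', isGoodCut n' X' Y' = true ∧
      momVal u v c (n, X, Y) + (gs.map (posSum u v c)).sum = momVal u v c (n', X', Y') := by
  induction gs generalizing n X Y with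
  | nil => exact ⟨n, X, Y, by simpa [checkCuts] using h, by simp⟩
  | cons g gs ih =>
    obtain ⟨s, hs, e⟩ : ∃ s ∈ g.tails ++ g.reverse.tails,
        posSum u v c g = momVal u v c (moments s) := by
      rcases hgs g List.mem_cons_self with hg | hg
      · obtain ⟨s, hs, e⟩ := exists_tail_posSum_eq hg
        exact ⟨s, List.mem_append_left _ hs, e⟩
      · obtain ⟨s, hs, e⟩ := exists_tail_posSum_eq (List.pairwise_reverse.2 hg)
        exact ⟨s, List.mem_append_right _ hs, by rw [← e, posSum_reverse]⟩
    rw [checkCuts, List.all_eq_true] at h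
    obtain ⟨n', X', Y', hgood, heq⟩ := ih (fun g hg => hgs g (List.mem_cons_of_mem _ hg))
      (h _ (List.mem_map_of_mem hs))
    refine ⟨n', X', Y', hgood, ?_⟩
    rw [← heq, List.map_cons, List.sum_cons, e]
    simp only [momVal]
    push_cast
    ring

lemma exists_isGoodCut (u v c : ℝ) :
    ∃ n X Y, isGoodCut n X Y = true ∧
      (atomRuns.map (posSum u v c)).sum = momVal u v c (n, X, Y) := by
  have hruns : ∀ g ∈ atomRuns, (g.Pairwise fun s t => atomVal u v c s ≤ atomVal u v c t) ∨
      g.Pairwise fun s t => atomVal u v c t ≤ atomVal u v c s := by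
    simp only [atomRuns, List.forall_mem_cons, List.pairwise_cons, atomVal]
    refine ⟨?_, ?_, ?_, ?_, by simp⟩
    · rcases le_total 0 (u + v) with h | h
      · left; norm_num; repeat' apply And.intro
        all_goals linarith
      · right; norm_num; repeat' apply And.intro
        all_goals linarith
    · rcases le_total 0 (v - u) with h | h
      · left; norm_num; repeat' apply And.intro
        all_goals linarith
      · right; norm_num; repeat' apply And.intro
        all_goals linarith
    all_goals
      rcases le_total 0 u with h | h
      · left; norm_num; linarith
      · right; norm_num; linarith
  obtain ⟨n, X, Y, hgood, heq⟩ := exists_isGoodCut_of_checkCuts hruns checkCuts_atomRuns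
  exact ⟨n, X, Y, hgood, by rw [← heq]; simp [momVal]⟩

/-! ### Distortion of pairs of points -/

lemma IsRMeasure.posPartInt_le_atomRuns {P : Measure (ℝ × ℝ)} [IsProbabilityMeasure P]
    (hP : IsRMeasure P) (A B C : ℝ) :
    posPartInt P A B C ≤ 1 / 100 * (atomRuns.map (posSum (A / 16) (B * √3 / 16) C)).sum := by
  have key (A' B' C' : ℝ) (t₁ t₂ t₃ : ℕ × ℕ × ℕ)
      (h₁ : C' = atomVal (A / 16) (B * √3 / 16) C t₁)
      (h₂ : A' + C' = atomVal (A / 16) (B * √3 / 16) C t₂)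
      (h₃ : A' / 2 + B' * √3 / 2 + C' = atomVal (A / 16) (B * √3 / 16) C t₃) :
      posPartInt P A' B' C' ≤ 1 / 4 * max (atomVal (A / 16) (B * √3 / 16) C t₁) 0
        + 1 / 4 * max (atomVal (A / 16) (B * √3 / 16) C t₂) 0
        + 1 / 2 * max (atomVal (A / 16) (B * √3 / 16) C t₃) 0 := by
    rw [← h₁, ← h₂, ← h₃]
    exact hP.posPartInt_le A' B' C'
  rw [hP.posPartInt_eq A, hP.posPartInt_eq (A / 2)]
  have k₁ := key (A / 4) (B / 4) C (5, 0, 0) (5, 4, 0) (10, 2, 2)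
    (by norm_num [atomVal]) (by norm_num [atomVal]; ring) (by norm_num [atomVal]; ring)
  have k₂ := key (A / 4) (B / 4) (C + 3 * A / 4) (5, 12, 0) (5, 16, 0) (10, 14, 2)
    (by norm_num [atomVal]; ring) (by norm_num [atomVal]; ring) (by norm_num [atomVal]; ring)
  have k₃ := key (A / 2 / 4) (B / 2 / 4) (C + A / 4 + B * √3 / 4) (3, 4, 4) (3, 6, 4) (6, 5, 5)
    (by norm_num [atomVal]; ring) (by norm_num [atomVal]; ring) (by norm_num [atomVal]; ring)
  have k₄ := key (A / 2 / 4) (B / 2 / 4) (C + A / 4 + B * √3 / 4 + 3 * (A / 2) / 4)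
    (3, 10, 4) (3, 12, 4) (6, 11, 5)
    (by norm_num [atomVal]; ring) (by norm_num [atomVal]; ring) (by norm_num [atomVal]; ring)
  have k₅ := key (A / 2 / 2) (B / 2 / 2)
    (C + A / 4 + B * √3 / 4 + A / 2 / 4 + B / 2 * √3 / 4) (9, 6, 6) (9, 10, 6) (18, 8, 8)
    (by norm_num [atomVal]; ring) (by norm_num [atomVal]; ring) (by norm_num [atomVal]; ring)
  simp only [atomRuns, posSum, List.map_cons, List.map_nil, List.sum_cons, List.sum_nil,
    Nat.cast_ofNat]
  linarith

/-- The pair of conditional means given the cells `1 ∪ 2` and `3`. -/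
noncomputable def optimalPair : Set (ℝ × ℝ) := {(1 / 2, √3 / 16), (1 / 2, 3 * √3 / 8)}

/-- The excess of the (second-moment free part of the) distortion of `{a, b}` along a cut with
mass and first moments `n, X, Y`. -/
noncomputable def excess (a b : ℝ × ℝ) (n X Y : ℕ) : ℝ :=
  b.1 ^ 2 + b.2 ^ 2 - b.1 - b.2 * √3 / 2 + 65 / 128 - 1 / 100 *
    momVal (2 * (a.1 - b.1) / 16) (2 * (a.2 - b.2) * √3 / 16)
      (b.1 ^ 2 + b.2 ^ 2 - a.1 ^ 2 - a.2 ^ 2) (n, X, Y)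

lemma eq_of_sum_sq_eq_zero {p q w x y z : ℝ} (hp : 0 < p) (hq : 0 < q)
    (h : p * (w ^ 2 + x ^ 2) + q * (y ^ 2 + z ^ 2) = 0) : w = 0 ∧ x = 0 ∧ y = 0 ∧ z = 0 := by
  have h₁ : w ^ 2 + x ^ 2 = 0 := by
    by_contra hne
    have : 0 < w ^ 2 + x ^ 2 := lt_of_le_of_ne (by positivity) (Ne.symm hne)
    have : 0 < p * (w ^ 2 + x ^ 2) + q * (y ^ 2 + z ^ 2) := by positivity
    linarith
  have h₂ : y ^ 2 + z ^ 2 = 0 := by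
    rw [h₁, mul_zero, zero_add] at h
    exact (mul_eq_zero.1 h).resolve_left hq.ne'
  refine ⟨?_, ?_, ?_, ?_⟩ <;> nlinarith [sq_nonneg w, sq_nonneg x, sq_nonneg y, sq_nonneg z]

lemma excess_nonneg_and {n X Y : ℕ} (h : isGoodCut n X Y = true) (a b : ℝ × ℝ) :
    0 ≤ excess a b n X Y ∧ (excess a b n X Y = 0 → ({a, b} : Set (ℝ × ℝ)) = optimalPair) := by
  obtain ⟨a₁, a₂⟩ := a
  obtain ⟨b₁, b₂⟩ := b
  have hsq : √3 ^ 2 = 3 := by norm_num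
  have of_pos (hpos : 0 < excess (a₁, a₂) (b₁, b₂) n X Y) :
      0 ≤ excess (a₁, a₂) (b₁, b₂) n X Y ∧ (excess (a₁, a₂) (b₁, b₂) n X Y = 0 →
        ({(a₁, a₂), (b₁, b₂)} : Set (ℝ × ℝ)) = optimalPair) :=
    ⟨hpos.le, fun h0 => absurd h0 hpos.ne'⟩
  simp only [isGoodCut, Bool.or_eq_true, Bool.and_eq_true, Nat.beq_eq, Nat.blt_eq] at h
  rcases h with (((⟨hn, hcut⟩ | ⟨⟨rfl, rfl⟩, rfl⟩) | ⟨⟨rfl, rfl⟩, rfl⟩) | ⟨⟨rfl, rfl⟩, rfl⟩) |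
    ⟨⟨rfl, rfl⟩, rfl⟩
  · apply of_pos
    have hn0 : 0 < n := by
      rcases Nat.eq_zero_or_pos n with rfl | h
      · simp at hcut
      · exact h
    have hn0 : (0 : ℝ) < n := by exact_mod_cast hn0
    have hn : (n : ℝ) < 100 := by exact_mod_cast hn
    have hcut : (5 * (X * X + 3 * (Y * Y)) + 650 * (n * n) : ℝ)
        < 9000 * n + 80 * (n * X) + 120 * (n * Y) := by exact_mod_cast hcut
    simp only [excess, momVal]
    generalize (n : ℝ) = N at *
    generalize (X : ℝ) = X at *
    generalize (Y : ℝ) = Y at *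
    have hp : 0 < N / 100 := by positivity
    have hq : 0 < 1 - N / 100 := by linarith
    refine pos_of_mul_pos_right (a := N / 100 * (1 - N / 100)) ?_ (mul_pos hp hq).le
    have h₁ : 0 ≤ (1 - N / 100) *
        ((N / 100 * a₁ - X / 1600) ^ 2 + (N / 100 * a₂ - √3 * Y / 1600) ^ 2) := by positivity
    have h₂ : 0 ≤ N / 100 * (((1 - N / 100) * b₁ - (1 / 2 - X / 1600)) ^ 2
        + ((1 - N / 100) * b₂ - √3 * (1 / 4 - Y / 1600)) ^ 2) := by positivity
    linear_combination h₁ + h₂ + 20 / 256000000 * hcut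
      + ((1 - N / 100) * Y ^ 2 / 1600 ^ 2 + N / 100 * (1 / 4 - Y / 1600) ^ 2) * hsq
  · have e : excess (a₁, a₂) (b₁, b₂) 60 480 360
        = 3 / 5 * ((a₁ - 1 / 2) ^ 2 + (a₂ - 3 * √3 / 8) ^ 2)
          + 2 / 5 * ((b₁ - 1 / 2) ^ 2 + (b₂ - √3 / 16) ^ 2) := by
      simp only [excess, momVal]
      push_cast
      linear_combination -(11 / 128) * hsq
    rw [e]
    refine ⟨by positivity, fun h0 => ?_⟩
    obtain ⟨h₁, h₂, h₃, h₄⟩ := eq_of_sum_sq_eq_zero (by norm_num) (by norm_num) h0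
    rw [sub_eq_zero.1 h₁, sub_eq_zero.1 h₂, sub_eq_zero.1 h₃, sub_eq_zero.1 h₄, Set.pair_comm]
    rfl
  · have e : excess (a₁, a₂) (b₁, b₂) 40 320 40
        = 2 / 5 * ((a₁ - 1 / 2) ^ 2 + (a₂ - √3 / 16) ^ 2)
          + 3 / 5 * ((b₁ - 1 / 2) ^ 2 + (b₂ - 3 * √3 / 8) ^ 2) := by
      simp only [excess, momVal]
      push_cast
      linear_combination -(11 / 128) * hsq
    rw [e]
    refine ⟨by positivity, fun h0 => ?_⟩
    obtain ⟨h₁, h₂, h₃, h₄⟩ := eq_of_sum_sq_eq_zero (by norm_num) (by norm_num) h0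
    rw [sub_eq_zero.1 h₁, sub_eq_zero.1 h₂, sub_eq_zero.1 h₃, sub_eq_zero.1 h₄]
    rfl
  · apply of_pos
    simp only [excess, momVal]
    push_cast
    nlinarith [sq_nonneg (b₁ - 1 / 2), sq_nonneg (b₂ - √3 / 4)]
  · apply of_pos
    simp only [excess, momVal]
    push_cast
    nlinarith [sq_nonneg (a₁ - 1 / 2), sq_nonneg (a₂ - √3 / 4)]

section Distortion

variable {P : Measure (ℝ × ℝ)} [IsProbabilityMeasure P]

lemma IsRMeasure.integral_sqDist (hP : IsRMeasure P) (b : ℝ × ℝ) :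
    ∫ x, sqDist x b ∂P
      = ∫ x, (x.1 ^ 2 + x.2 ^ 2) ∂P + (b.1 ^ 2 + b.2 ^ 2 - b.1 - b.2 * √3 / 2) := by
  have e (x : ℝ × ℝ) : sqDist x b = (x.1 ^ 2 + x.2 ^ 2)
      + (-2 * b.1 * x.1 + -2 * b.2 * x.2 + (b.1 ^ 2 + b.2 ^ 2)) := by
    unfold sqDist; ring
  simp only [e]
  rw [integral_add (hP.integrable (by fun_prop)) (hP.integrable (by fun_prop)),
    hP.integral_affine]
  ring

lemma IsRMeasure.distortion_pair (hP : IsRMeasure P) (a b : ℝ × ℝ) :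
    distortion P {a, b} = ∫ x, (x.1 ^ 2 + x.2 ^ 2) ∂P
      + (b.1 ^ 2 + b.2 ^ 2 - b.1 - b.2 * √3 / 2)
      - posPartInt P (2 * (a.1 - b.1)) (2 * (a.2 - b.2))
        (b.1 ^ 2 + b.2 ^ 2 - a.1 ^ 2 - a.2 ^ 2) := by
  rw [← hP.integral_sqDist, posPartInt, ← integral_sub
    (hP.integrable (by unfold sqDist; fun_prop)) (hP.integrable (by fun_prop))]
  unfold distortion
  congr 1 with x
  rw [Set.image_pair, csInf_pair]
  have e : 2 * (a.1 - b.1) * x.1 + 2 * (a.2 - b.2) * x.2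
      + (b.1 ^ 2 + b.2 ^ 2 - a.1 ^ 2 - a.2 ^ 2) = sqDist x b - sqDist x a := by
    unfold sqDist; ring
  rw [e]
  rcases le_total (sqDist x a) (sqDist x b) with h | h
  · rw [max_eq_left (by linarith), inf_eq_left.2 h]; ring
  · rw [max_eq_right (by linarith), inf_eq_right.2 h]; ring

/-- Lower bound for the distortion of a pair, with its equality case. -/
lemma IsRMeasure.le_distortion_pair (hP : IsRMeasure P) (a b : ℝ × ℝ) :
    ∫ x, (x.1 ^ 2 + x.2 ^ 2) ∂P - 65 / 128 ≤ distortion P {a, b} ∧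
      (distortion P {a, b} ≤ ∫ x, (x.1 ^ 2 + x.2 ^ 2) ∂P - 65 / 128 →
        ({a, b} : Set (ℝ × ℝ)) = optimalPair) := by
  have hle := hP.posPartInt_le_atomRuns (2 * (a.1 - b.1)) (2 * (a.2 - b.2))
    (b.1 ^ 2 + b.2 ^ 2 - a.1 ^ 2 - a.2 ^ 2)
  obtain ⟨n, X, Y, hgood, heq⟩ := exists_isGoodCut (2 * (a.1 - b.1) / 16)
    (2 * (a.2 - b.2) * √3 / 16) (b.1 ^ 2 + b.2 ^ 2 - a.1 ^ 2 - a.2 ^ 2)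
  obtain ⟨h₀, h₁⟩ := excess_nonneg_and hgood a b
  rw [heq] at hle
  rw [hP.distortion_pair]
  have hex : excess a b n X Y = b.1 ^ 2 + b.2 ^ 2 - b.1 - b.2 * √3 / 2 + 65 / 128
      - 1 / 100 * momVal (2 * (a.1 - b.1) / 16) (2 * (a.2 - b.2) * √3 / 16)
        (b.1 ^ 2 + b.2 ^ 2 - a.1 ^ 2 - a.2 ^ 2) (n, X, Y) := rfl
  exact ⟨by linarith, fun h => h₁ (le_antisymm (by linarith) h₀)⟩

lemma IsRMeasure.distortion_optimalPair_le (hP : IsRMeasure P) :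
    distortion P optimalPair ≤ ∫ x, (x.1 ^ 2 + x.2 ^ 2) ∂P - 65 / 128 := by
  have hsq : √3 ^ 2 = 3 := by norm_num
  rw [optimalPair, Set.pair_comm, hP.distortion_pair, hP.posPartInt_eq]
  dsimp only
  have h := hP.le_posPartInt (2 * (1 / 2 - 1 / 2) / 2) (2 * (3 * √3 / 8 - √3 / 16) / 2)
    ((1 / 2) ^ 2 + (√3 / 16) ^ 2 - (1 / 2) ^ 2 - (3 * √3 / 8) ^ 2
      + 2 * (1 / 2 - 1 / 2) / 4 + 2 * (3 * √3 / 8 - √3 / 16) * √3 / 4)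
  have h₀ := posPartInt_nonneg (P := P) (2 * (1 / 2 - 1 / 2) / 4)
    (2 * (3 * √3 / 8 - √3 / 16) / 4)
    ((1 / 2) ^ 2 + (√3 / 16) ^ 2 - (1 / 2) ^ 2 - (3 * √3 / 8) ^ 2)
  have h₁ := posPartInt_nonneg (P := P) (2 * (1 / 2 - 1 / 2) / 4)
    (2 * (3 * √3 / 8 - √3 / 16) / 4)
    ((1 / 2) ^ 2 + (√3 / 16) ^ 2 - (1 / 2) ^ 2 - (3 * √3 / 8) ^ 2 + 3 * (2 * (1 / 2 - 1 / 2)) / 4)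
  nlinarith

end Distortion

lemma eq_empty_or_exists_eq_pair {β : Type*} {s : Set β} (h : s.encard ≤ 2) :
    s = ∅ ∨ ∃ a b, s = {a, b} := by
  rcases h.lt_or_eq with h | h
  · rcases Set.encard_le_one_iff_eq.1 (Order.le_of_lt_add_one (by rwa [one_add_one_eq_two]))
      with h | ⟨a, rfl⟩
    · exact Or.inl h
    · exact Or.inr ⟨a, a, by simp⟩
  · obtain ⟨a, b, -, rfl⟩ := Set.encard_eq_two.1 h
    exact Or.inr ⟨a, b, rfl⟩

/-- Uniqueness of the optimal set of two-means: every set α ⊆ ℝ² with card α ≤ 2 whose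
distortion error equals `V₂(P)` is `{(1/2, √3/16), (1/2, 3√3/8)}`. -/
theorem stmt_10 (P : Measure (ℝ × ℝ)) [IsProbabilityMeasure P] (hP : IsRMeasure P)
    (α : Set (ℝ × ℝ)) (hcard : α.encard ≤ 2)
    (hopt : distortion P α = quantErr P 2) :
    α = ({(1/2, Real.sqrt 3 / 16), (1/2, 3 * Real.sqrt 3 / 8)} : Set (ℝ × ℝ)) := by
  have hV := hP.lt_integral_sq_add_sq
  have hlow : ∫ x, (x.1 ^ 2 + x.2 ^ 2) ∂P - 65 / 128 ≤ quantErr P 2 := by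
    refine le_csInf ⟨_, {(0, 0)}, by simp, by simp, rfl⟩ ?_
    rintro v ⟨β, hβ, hβ', rfl⟩
    obtain rfl | ⟨a, b, rfl⟩ := eq_empty_or_exists_eq_pair (by exact_mod_cast hβ')
    · simp at hβ
    · exact (hP.le_distortion_pair a b).1
  have hup : quantErr P 2 ≤ distortion P optimalPair := by
    refine csInf_le ⟨0, ?_⟩ ⟨optimalPair, ?_, ?_, rfl⟩
    · rintro v ⟨β, -, -, rfl⟩
      refine integral_nonneg fun x => Real.sInf_nonneg ?_
      rintro _ ⟨a, -, rfl⟩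
      exact add_nonneg (sq_nonneg _) (sq_nonneg _)
    · exact Set.one_le_encard_iff_nonempty.2 ⟨_, Set.mem_insert _ _⟩
    · exact (Set.encard_insert_le _ _).trans (by simp [one_add_one_eq_two])
  obtain rfl | ⟨a, b, rfl⟩ := eq_empty_or_exists_eq_pair hcard
  · have h0 : distortion P ∅ = 0 := by simp [distortion]
    linarith
  · exact (hP.le_distortion_pair a b).2
      (hopt.le.trans (hup.trans hP.distortion_optimalPair_le))
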